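/- Suppose Assumption 1 holds, only Y is mismeasured (Z'=Z and D'=D almost surely), the measurement error of Y is non-differential with respect to the potential values (Y' is independent of (Z, D_1, D_0, Y_1, Y_0) given Y), all conditioning events have positive probability, P(U=u) > 0 for u=a,n,c, r_Y > 0, and CACE' := RD_{Y'|Z}/RD_{D|Z} ≥ 0. Let M_Y and N_Y be the maximum and minimum of the set {P(Y'=1|D=0,Z=1), P(Y'=1|D=1,Z=0), RD_{Y'D|Z}/RD_{D|Z}, RD_{Y'(1−D)|(1−Z)}/RD_{D|Z}}. Then SN_Y ≥ M_Y, SP_Y ≥ 1 − N_Y, and the bounds CACE' ≤ CACE and CACE × (M_Y − N_Y) ≤ CACE' hold, where CACE = E(Y_1 − Y_0 | U=c). -/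

import Mathlib

open MeasureTheory ProbabilityTheory

noncomputable def pr {Ω : Type*} [MeasurableSpace Ω] (μ : MeasureTheory.Measure Ω)
    (A : Set Ω) : ℝ := (μ A).toReal

noncomputable def cpr {Ω : Type*} [MeasurableSpace Ω] (μ : MeasureTheory.Measure Ω)
    (B A : Set Ω) : ℝ := (ProbabilityTheory.cond μ B A).toReal

def bin01 : Set ℝ := {0, 1}

theorem measureReal_split_binary {Ω : Type*} [MeasurableSpace Ω] (μ : Measure Ω)
    [IsFiniteMeasure μ] {X : Ω → ℝ} (hX : Measurable X) (hb : ∀ ω, X ω = 0 ∨ X ω = 1)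
    (p : Ω → Prop) :
    μ.real {ω | p ω} = μ.real {ω | p ω ∧ X ω = 1} + μ.real {ω | p ω ∧ X ω = 0} := by
  have h := measureReal_inter_add_sdiff (μ := μ) (s := {ω | p ω})
    (hX (measurableSet_singleton (1 : ℝ)))
  rw [← h]
  congr 2
  ext ω
  have := hb ω
  simp only [Set.mem_sdiff, Set.mem_preimage, Set.mem_singleton_iff, Set.mem_ofPred_eq]
  grind

theorem cpr_eq_div {Ω : Type*} [MeasurableSpace Ω] (μ : Measure Ω)
    {B : Set Ω} (hB : MeasurableSet B) (A : Set Ω) :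
    cpr μ B A = μ.real (B ∩ A) / μ.real B := by
  rw [cpr, cond_apply hB, ENNReal.toReal_mul, ENNReal.toReal_inv, inv_mul_eq_div]
  rfl

theorem cpr_mul_real {Ω : Type*} [MeasurableSpace Ω] (μ : Measure Ω)
    [IsFiniteMeasure μ] {B : Set Ω} (hB : MeasurableSet B) (A : Set Ω) :
    μ.real (B ∩ A) = cpr μ B A * μ.real B := by
  rw [cpr_eq_div μ hB]
  rcases eq_or_ne (μ.real B) 0 with h | h
  · rw [h, mul_zero]
    exact measureReal_mono_null Set.inter_subset_left h
  · field_simp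

theorem cpr_nonneg {Ω : Type*} [MeasurableSpace Ω] (μ : Measure Ω) (B A : Set Ω) :
    0 ≤ cpr μ B A := ENNReal.toReal_nonneg

theorem cpr_binary_add {Ω : Type*} [MeasurableSpace Ω] (μ : Measure Ω)
    [IsFiniteMeasure μ] {X : Ω → ℝ} (hX : Measurable X) (hb : ∀ ω, X ω = 0 ∨ X ω = 1)
    {B : Set Ω} (h0 : μ B ≠ 0) :
    cpr μ B {ω | X ω = 1} + cpr μ B {ω | X ω = 0} = 1 := by
  have := cond_isProbabilityMeasure h0
  have h := measureReal_split_binary (cond μ B) hX hb (fun _ => True)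
  simp only [Set.ofPred_true, probReal_univ, true_and] at h
  exact h.symm

theorem integral_binary {Ω : Type*} [MeasurableSpace Ω] (μ : Measure Ω)
    {X : Ω → ℝ} (hX : Measurable X) (hb : ∀ ω, X ω = 0 ∨ X ω = 1) :
    ∫ ω, X ω ∂μ = μ.real {ω | X ω = 1} := by
  have h : MeasurableSet {ω | X ω = 1} := hX (measurableSet_singleton (1 : ℝ))
  rw [← integral_indicator_one h]
  congr 1
  ext ω
  rcases hb ω with h | h <;> simp [Set.indicator, h]

theorem integrable_binary {Ω : Type*} [MeasurableSpace Ω] (μ : Measure Ω) [IsFiniteMeasure μ]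
    {X : Ω → ℝ} (hX : Measurable X) (hb : ∀ ω, X ω = 0 ∨ X ω = 1) :
    Integrable X μ :=
  Integrable.of_bound hX.aestronglyMeasurable 1 <|
    ae_of_all _ fun ω => by rcases hb ω with h | h <;> simp [h]

theorem mixture_mem_Icc {f r a p : ℝ} (hr : 0 < r) (hp : 0 < p) (ha : 0 ≤ a) (hap : a ≤ p) :
    f + r * (a / p) ∈ Set.Icc f (f + r) := by
  have h0 : 0 ≤ a / p := by positivity
  have h1 : a / p ≤ 1 := (div_le_one hp).2 hap
  constructor <;> nlinarith

theorem bounds_of_mixtures {f r w₁ w₂ w₃ w₄ x y : ℝ} (hr : 0 < r) (hr1 : r ≤ 1)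
    (h₁ : w₁ ∈ Set.Icc f (f + r)) (h₂ : w₂ ∈ Set.Icc f (f + r))
    (h₃ : w₃ ∈ Set.Icc f (f + r)) (h₄ : w₄ ∈ Set.Icc f (f + r))
    (hy : y = r * x) (hy0 : 0 ≤ y) :
    max (max w₁ w₂) (max w₃ w₄) ≤ f + r ∧ f ≤ min (min w₁ w₂) (min w₃ w₄) ∧ y ≤ x ∧
      x * (max (max w₁ w₂) (max w₃ w₄) - min (min w₁ w₂) (min w₃ w₄)) ≤ y := by
  have hM : max (max w₁ w₂) (max w₃ w₄) ≤ f + r := by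
    simp only [max_le_iff]
    exact ⟨⟨h₁.2, h₂.2⟩, h₃.2, h₄.2⟩
  have hN : f ≤ min (min w₁ w₂) (min w₃ w₄) := by
    simp only [le_min_iff]
    exact ⟨⟨h₁.1, h₂.1⟩, h₃.1, h₄.1⟩
  have hx : 0 ≤ x := by
    rw [hy] at hy0
    exact nonneg_of_mul_nonneg_right hy0 hr
  refine ⟨hM, hN, by nlinarith, ?_⟩
  rw [hy, mul_comm r]
  exact mul_le_mul_of_nonneg_left (by linarith) hx

set_option maxHeartbeats 1000000 in
theorem stmt5 {Ω : Type*} [MeasurableSpace Ω]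
    (μ : MeasureTheory.Measure Ω) [IsProbabilityMeasure μ]
    (Z D Y Y' D1 D0 Y1 Y0 : Ω → ℝ)
    (h_meas_Z : Measurable Z)
    (h_meas_D : Measurable D)
    (h_meas_Y : Measurable Y)
    (h_meas_Yp : Measurable Y')
    (h_meas_D1 : Measurable D1)
    (h_meas_D0 : Measurable D0)
    (h_meas_Y1 : Measurable Y1)
    (h_meas_Y0 : Measurable Y0)
    (h_bin_Z : ∀ ω, Z ω = 0 ∨ Z ω = 1)
    (h_bin_Yp : ∀ ω, Y' ω = 0 ∨ Y' ω = 1)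
    (h_bin_D1 : ∀ ω, D1 ω = 0 ∨ D1 ω = 1)
    (h_bin_D0 : ∀ ω, D0 ω = 0 ∨ D0 ω = 1)
    (h_bin_Y1 : ∀ ω, Y1 ω = 0 ∨ Y1 ω = 1)
    (h_bin_Y0 : ∀ ω, Y0 ω = 0 ∨ Y0 ω = 1)
    (h_consD : ∀ ω, D ω = Z ω * D1 ω + (1 - Z ω) * D0 ω)
    (h_consY : ∀ ω, Y ω = Z ω * Y1 ω + (1 - Z ω) * Y0 ω)
    (h_indep : IndepFun Z (fun ω => (Y1 ω, Y0 ω, D1 ω, D0 ω)) μ)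
    (h_mono : ∀ᵐ ω ∂μ, D0 ω ≤ D1 ω)
    (h_exclA : cpr μ {ω | D1 ω = 1 ∧ D0 ω = 1} {ω | Y1 ω = 1}
        = cpr μ {ω | D1 ω = 1 ∧ D0 ω = 1} {ω | Y0 ω = 1})
    (h_exclN : cpr μ {ω | D1 ω = 0 ∧ D0 ω = 0} {ω | Y1 ω = 1}
        = cpr μ {ω | D1 ω = 0 ∧ D0 ω = 0} {ω | Y0 ω = 1})
    (h_ndY : ∀ y ∈ bin01, ∀ y' ∈ bin01, ∀ z ∈ bin01, ∀ d1 ∈ bin01, ∀ d0 ∈ bin01, ∀ y1 ∈ bin01, ∀ y0 ∈ bin01,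
      μ ({ω | Y ω = y} ∩ {ω | Z ω = z} ∩ {ω | D1 ω = d1} ∩ {ω | D0 ω = d0} ∩ {ω | Y1 ω = y1} ∩ {ω | Y0 ω = y0}) ≠ 0 →
      cpr μ ({ω | Y ω = y} ∩ {ω | Z ω = z} ∩ {ω | D1 ω = d1} ∩ {ω | D0 ω = d0} ∩ {ω | Y1 ω = y1} ∩ {ω | Y0 ω = y0}) {ω | Y' ω = y'}
        = cpr μ {ω | Y ω = y} {ω | Y' ω = y'})
    (h_posDZ : ∀ d ∈ bin01, ∀ z ∈ bin01,
      μ ({ω | D ω = d} ∩ {ω | Z ω = z}) ≠ 0)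
    (h_posY : ∀ y ∈ bin01, μ {ω | Y ω = y} ≠ 0)
    (h_Ua : 0 < pr μ {ω | D1 ω = 1 ∧ D0 ω = 1})
    (h_Un : 0 < pr μ {ω | D1 ω = 0 ∧ D0 ω = 0})
    (h_Uc : 0 < pr μ {ω | D1 ω = 1 ∧ D0 ω = 0})
    (SNY SPY : ℝ)
    (h_SNY : SNY = cpr μ {ω | Y ω = 1} {ω | Y' ω = 1})
    (h_SPY : SPY = cpr μ {ω | Y ω = 0} {ω | Y' ω = 0})
    (h_rY : 0 < SNY + SPY - 1)
    (RDD CACE CACE' MY NY : ℝ)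
    (h_RDD : RDD = (cpr μ {ω | Z ω = 1} {ω | D ω = 1} - cpr μ {ω | Z ω = 0} {ω | D ω = 1}))
    (h_CACE : CACE = ∫ ω, (Y1 ω - Y0 ω) ∂(ProbabilityTheory.cond μ {ω | D1 ω = 1 ∧ D0 ω = 0}))
    (h_CACE' : CACE' = (cpr μ {ω | Z ω = 1} {ω | Y' ω = 1} - cpr μ {ω | Z ω = 0} {ω | Y' ω = 1}) / RDD)
    (h_CACE'_nonneg : 0 ≤ CACE')
    (h_MY : MY = max (max (cpr μ ({ω | D ω = 0} ∩ {ω | Z ω = 1}) {ω | Y' ω = 1}) (cpr μ ({ω | D ω = 1} ∩ {ω | Z ω = 0}) {ω | Y' ω = 1}))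
        (max ((cpr μ {ω | Z ω = 1} ({ω | Y' ω = 1} ∩ {ω | D ω = 1}) - cpr μ {ω | Z ω = 0} ({ω | Y' ω = 1} ∩ {ω | D ω = 1})) / RDD) ((cpr μ {ω | Z ω = 0} ({ω | Y' ω = 1} ∩ {ω | D ω = 0}) - cpr μ {ω | Z ω = 1} ({ω | Y' ω = 1} ∩ {ω | D ω = 0})) / RDD)))
    (h_NY : NY = min (min (cpr μ ({ω | D ω = 0} ∩ {ω | Z ω = 1}) {ω | Y' ω = 1}) (cpr μ ({ω | D ω = 1} ∩ {ω | Z ω = 0}) {ω | Y' ω = 1}))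
        (min ((cpr μ {ω | Z ω = 1} ({ω | Y' ω = 1} ∩ {ω | D ω = 1}) - cpr μ {ω | Z ω = 0} ({ω | Y' ω = 1} ∩ {ω | D ω = 1})) / RDD) ((cpr μ {ω | Z ω = 0} ({ω | Y' ω = 1} ∩ {ω | D ω = 0}) - cpr μ {ω | Z ω = 1} ({ω | Y' ω = 1} ∩ {ω | D ω = 0})) / RDD))) :
    MY ≤ SNY ∧ 1 - NY ≤ SPY ∧ CACE' ≤ CACE ∧ CACE * (MY - NY) ≤ CACE' := by
  have mZ : ∀ z, MeasurableSet {ω | Z ω = z} := fun z => h_meas_Z (measurableSet_singleton z)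
  have mD : ∀ z, MeasurableSet {ω | D ω = z} := fun z => h_meas_D (measurableSet_singleton z)
  have mY : ∀ z, MeasurableSet {ω | Y ω = z} := fun z => h_meas_Y (measurableSet_singleton z)
  have mD1 : ∀ z, MeasurableSet {ω | D1 ω = z} := fun z => h_meas_D1 (measurableSet_singleton z)
  have mD0 : ∀ z, MeasurableSet {ω | D0 ω = z} := fun z => h_meas_D0 (measurableSet_singleton z)
  have mY1 : ∀ z, MeasurableSet {ω | Y1 ω = z} := fun z => h_meas_Y1 (measurableSet_singleton z)
  have mY0 : ∀ z, MeasurableSet {ω | Y0 ω = z} := fun z => h_meas_Y0 (measurableSet_singleton z)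
  have mU : ∀ a b, MeasurableSet {ω | D1 ω = a ∧ D0 ω = b} := fun a b => (mD1 a).inter (mD0 b)
  have b0 : (0 : ℝ) ∈ bin01 := Or.inl rfl
  have b1 : (1 : ℝ) ∈ bin01 := Or.inr rfl
  have spec1 : cpr μ {ω | Y ω = 1} {ω | Y' ω = 1} ≤ 1 := by
    have h := cpr_binary_add μ h_meas_Yp h_bin_Yp (h_posY 1 b1)
    linarith [cpr_nonneg μ {ω | Y ω = 1} {ω | Y' ω = 0}]
  have spec0 : cpr μ {ω | Y ω = 0} {ω | Y' ω = 1} = 1 - SPY := by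
    have h := cpr_binary_add μ h_meas_Yp h_bin_Yp (h_posY 0 b0)
    linarith
  have hf0 : 0 ≤ 1 - SPY := spec0 ▸ cpr_nonneg _ _ _
  have indep : ∀ z (S : Set (ℝ × ℝ × ℝ × ℝ)), MeasurableSet S →
      μ.real ({ω | Z ω = z} ∩ (fun ω => (Y1 ω, Y0 ω, D1 ω, D0 ω)) ⁻¹' S) =
        μ.real {ω | Z ω = z} * μ.real ((fun ω => (Y1 ω, Y0 ω, D1 ω, D0 ω)) ⁻¹' S) := by
    intro z S hS
    have h := h_indep.measure_inter_preimage_eq_mul {z} S (measurableSet_singleton z) hS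
    simp only [measureReal_def, ← ENNReal.toReal_mul]
    exact congrArg ENNReal.toReal h
  have indepU : ∀ z d1 d0, μ.real {ω | (Z ω = z ∧ D1 ω = d1) ∧ D0 ω = d0} =
      μ.real {ω | Z ω = z} * μ.real {ω | D1 ω = d1 ∧ D0 ω = d0} := by
    intro z d1 d0
    have h := indep z {v | v.2.2.1 = d1 ∧ v.2.2.2 = d0} (by measurability)
    simp only [and_assoc]
    exact h
  have cell : ∀ z ∈ bin01, ∀ d1 ∈ bin01, ∀ d0 ∈ bin01, ∀ y1 ∈ bin01, ∀ y0 ∈ bin01,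
      ∀ y ∈ bin01, y = z * y1 + (1 - z) * y0 →
      μ.real {ω | ((((Z ω = z ∧ D1 ω = d1) ∧ D0 ω = d0) ∧ Y' ω = 1) ∧ Y1 ω = y1) ∧ Y0 ω = y0} =
        μ.real {ω | Z ω = z} * μ.real {ω | ((D1 ω = d1 ∧ D0 ω = d0) ∧ Y1 ω = y1) ∧ Y0 ω = y0} *
          cpr μ {ω | Y ω = y} {ω | Y' ω = 1} := by
    intro z hz d1 hd1 d0 hd0 y1 hy1 y0 hy0 y hy hyz
    have h := indep z {v | v.1 = y1 ∧ v.2.1 = y0 ∧ v.2.2.1 = d1 ∧ v.2.2.2 = d0}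
      (by measurability)
    have e1 : {ω | Z ω = z} ∩ (fun ω => (Y1 ω, Y0 ω, D1 ω, D0 ω)) ⁻¹'
        {v | v.1 = y1 ∧ v.2.1 = y0 ∧ v.2.2.1 = d1 ∧ v.2.2.2 = d0} =
        {ω | Y ω = y} ∩ {ω | Z ω = z} ∩ {ω | D1 ω = d1} ∩ {ω | D0 ω = d0} ∩
          {ω | Y1 ω = y1} ∩ {ω | Y0 ω = y0} := by
      ext ω
      have := h_consY ω
      simp only [Set.mem_inter_iff, Set.mem_preimage, Set.mem_ofPred_eq]
      constructor
      · rintro ⟨h1, h2, h3, h4, h5⟩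
        rw [h1, h2, h3] at this
        exact ⟨⟨⟨⟨⟨this.trans hyz.symm, h1⟩, h4⟩, h5⟩, h2⟩, h3⟩
      · tauto
    have e2 : (fun ω => (Y1 ω, Y0 ω, D1 ω, D0 ω)) ⁻¹'
        {v | v.1 = y1 ∧ v.2.1 = y0 ∧ v.2.2.1 = d1 ∧ v.2.2.2 = d0} =
        {ω | ((D1 ω = d1 ∧ D0 ω = d0) ∧ Y1 ω = y1) ∧ Y0 ω = y0} := by
      ext ω
      simp only [Set.mem_preimage, Set.mem_ofPred_eq]
      tauto
    have e3 : {ω | ((((Z ω = z ∧ D1 ω = d1) ∧ D0 ω = d0) ∧ Y' ω = 1) ∧ Y1 ω = y1) ∧ Y0 ω = y0} =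
        ({ω | Y ω = y} ∩ {ω | Z ω = z} ∩ {ω | D1 ω = d1} ∩ {ω | D0 ω = d0} ∩
          {ω | Y1 ω = y1} ∩ {ω | Y0 ω = y0}) ∩ {ω | Y' ω = 1} := by
      rw [← e1, e2]
      ext ω
      simp only [Set.mem_inter_iff, Set.mem_ofPred_eq]
      tauto
    rw [e1, e2] at h
    rw [e3, ← h]
    set B := {ω | Y ω = y} ∩ {ω | Z ω = z} ∩ {ω | D1 ω = d1} ∩ {ω | D0 ω = d0} ∩
          {ω | Y1 ω = y1} ∩ {ω | Y0 ω = y0} with hB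
    have mB : MeasurableSet B :=
      (((((mY y).inter (mZ z)).inter (mD1 d1)).inter (mD0 d0)).inter (mY1 y1)).inter (mY0 y0)
    by_cases hB0 : μ B = 0
    · rw [(measureReal_eq_zero_iff).2 hB0, zero_mul]
      exact (measureReal_eq_zero_iff).2 (measure_mono_null Set.inter_subset_left hB0)
    · rw [cpr_mul_real μ mB, h_ndY y hy 1 b1 z hz d1 hd1 d0 hd0 y1 hy1 y0 hy0 hB0, mul_comm]
  have joint1 : ∀ d1 ∈ bin01, ∀ d0 ∈ bin01,
      μ.real {ω | ((Z ω = 1 ∧ D1 ω = d1) ∧ D0 ω = d0) ∧ Y' ω = 1} =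
        μ.real {ω | Z ω = 1} * ((1 - SPY) * μ.real {ω | D1 ω = d1 ∧ D0 ω = d0} +
          (SNY + SPY - 1) * μ.real {ω | (D1 ω = d1 ∧ D0 ω = d0) ∧ Y1 ω = 1}) := by
    intro d1 hd1 d0 hd0
    rw [measureReal_split_binary μ h_meas_Y1 h_bin_Y1,
      measureReal_split_binary μ h_meas_Y0 h_bin_Y0,
      measureReal_split_binary μ h_meas_Y0 h_bin_Y0 (fun ω => _ ∧ Y1 ω = 0),
      cell 1 b1 d1 hd1 d0 hd0 1 b1 1 b1 1 b1 (by norm_num),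
      cell 1 b1 d1 hd1 d0 hd0 1 b1 0 b0 1 b1 (by norm_num),
      cell 1 b1 d1 hd1 d0 hd0 0 b0 1 b1 0 b0 (by norm_num),
      cell 1 b1 d1 hd1 d0 hd0 0 b0 0 b0 0 b0 (by norm_num), spec0, ← h_SNY,
      measureReal_split_binary μ h_meas_Y1 h_bin_Y1 (fun ω => D1 ω = d1 ∧ D0 ω = d0),
      measureReal_split_binary μ h_meas_Y0 h_bin_Y0 (fun ω => _ ∧ Y1 ω = 1),
      measureReal_split_binary μ h_meas_Y0 h_bin_Y0 (fun ω => _ ∧ Y1 ω = 0)]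
    ring
  have joint0 : ∀ d1 ∈ bin01, ∀ d0 ∈ bin01,
      μ.real {ω | ((Z ω = 0 ∧ D1 ω = d1) ∧ D0 ω = d0) ∧ Y' ω = 1} =
        μ.real {ω | Z ω = 0} * ((1 - SPY) * μ.real {ω | D1 ω = d1 ∧ D0 ω = d0} +
          (SNY + SPY - 1) * μ.real {ω | (D1 ω = d1 ∧ D0 ω = d0) ∧ Y0 ω = 1}) := by
    intro d1 hd1 d0 hd0
    rw [measureReal_split_binary μ h_meas_Y1 h_bin_Y1,
      measureReal_split_binary μ h_meas_Y0 h_bin_Y0,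
      measureReal_split_binary μ h_meas_Y0 h_bin_Y0 (fun ω => _ ∧ Y1 ω = 0),
      cell 0 b0 d1 hd1 d0 hd0 1 b1 1 b1 1 b1 (by norm_num),
      cell 0 b0 d1 hd1 d0 hd0 1 b1 0 b0 0 b0 (by norm_num),
      cell 0 b0 d1 hd1 d0 hd0 0 b0 1 b1 1 b1 (by norm_num),
      cell 0 b0 d1 hd1 d0 hd0 0 b0 0 b0 0 b0 (by norm_num), spec0, ← h_SNY,
      measureReal_split_binary μ h_meas_Y1 h_bin_Y1 (fun ω => D1 ω = d1 ∧ D0 ω = d0),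
      measureReal_split_binary μ h_meas_Y1 h_bin_Y1 (fun ω => (D1 ω = d1 ∧ D0 ω = d0) ∧ Y0 ω = 1),
      measureReal_split_binary μ h_meas_Y0 h_bin_Y0 (fun ω => _ ∧ Y1 ω = 1),
      measureReal_split_binary μ h_meas_Y0 h_bin_Y0 (fun ω => _ ∧ Y1 ω = 0)]
    simp only [and_right_comm (b := Y0 _ = 1)]
    ring
  have defier : μ {ω | D1 ω = 0 ∧ D0 ω = 1} = 0 := by
    refine measure_mono_null ?_ (ae_iff.1 h_mono)
    rintro ω ⟨h1, h0⟩
    simp [h1, h0]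
  have defierR : μ.real {ω | D1 ω = 0 ∧ D0 ω = 1} = 0 := (measureReal_eq_zero_iff).2 defier
  have defierY : ∀ p : Ω → Prop, μ.real {ω | (D1 ω = 0 ∧ D0 ω = 1) ∧ p ω} = 0 := fun p =>
    (measureReal_eq_zero_iff).2 (measure_mono_null (fun ω h => h.1) defier)
  have exA : μ.real {ω | (D1 ω = 1 ∧ D0 ω = 1) ∧ Y1 ω = 1} =
      μ.real {ω | (D1 ω = 1 ∧ D0 ω = 1) ∧ Y0 ω = 1} := by
    have h := cpr_mul_real μ (mU 1 1) {ω | Y1 ω = 1}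
    rw [h_exclA, ← cpr_mul_real μ (mU 1 1)] at h
    exact h
  have exN : μ.real {ω | (D1 ω = 0 ∧ D0 ω = 0) ∧ Y1 ω = 1} =
      μ.real {ω | (D1 ω = 0 ∧ D0 ω = 0) ∧ Y0 ω = 1} := by
    have h := cpr_mul_real μ (mU 0 0) {ω | Y1 ω = 1}
    rw [h_exclN, ← cpr_mul_real μ (mU 0 0)] at h
    exact h
  have sub : ∀ (a b : ℝ) (p : Ω → Prop), μ.real {ω | (D1 ω = a ∧ D0 ω = b) ∧ p ω} ≤
      μ.real {ω | D1 ω = a ∧ D0 ω = b} := fun a b p => measureReal_mono fun ω h => h.1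
  have hq : ∀ z ∈ bin01, 0 < μ.real {ω | Z ω = z} := by
    intro z hz
    refine lt_of_le_of_ne measureReal_nonneg fun h => h_posDZ 0 b0 z hz ?_
    exact measure_mono_null Set.inter_subset_right ((measureReal_eq_zero_iff).1 h.symm)
  have D_Z1 : ∀ ω, Z ω = 1 → D ω = D1 ω := fun ω h => by rw [h_consD, h]; ring
  have D_Z0 : ∀ ω, Z ω = 0 → D ω = D0 ω := fun ω h => by rw [h_consD, h]; ring
  have num1 : ∀ d, μ.real ({ω | Z ω = 1} ∩ ({ω | Y' ω = 1} ∩ {ω | D ω = d})) =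
      μ.real {ω | ((Z ω = 1 ∧ D1 ω = d) ∧ D0 ω = 1) ∧ Y' ω = 1} +
        μ.real {ω | ((Z ω = 1 ∧ D1 ω = d) ∧ D0 ω = 0) ∧ Y' ω = 1} := by
    intro d
    have e : {ω | Z ω = 1} ∩ ({ω | Y' ω = 1} ∩ {ω | D ω = d}) =
        {ω | (Z ω = 1 ∧ D1 ω = d) ∧ Y' ω = 1} := by
      ext ω
      have := D_Z1 ω
      simp only [Set.mem_inter_iff, Set.mem_ofPred_eq]
      grind
    rw [e, measureReal_split_binary μ h_meas_D0 h_bin_D0]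
    simp only [and_right_comm (b := Y' _ = 1)]
  have num0 : ∀ d, μ.real ({ω | Z ω = 0} ∩ ({ω | Y' ω = 1} ∩ {ω | D ω = d})) =
      μ.real {ω | ((Z ω = 0 ∧ D1 ω = 1) ∧ D0 ω = d) ∧ Y' ω = 1} +
        μ.real {ω | ((Z ω = 0 ∧ D1 ω = 0) ∧ D0 ω = d) ∧ Y' ω = 1} := by
    intro d
    have e : {ω | Z ω = 0} ∩ ({ω | Y' ω = 1} ∩ {ω | D ω = d}) =
        {ω | (Z ω = 0 ∧ D0 ω = d) ∧ Y' ω = 1} := by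
      ext ω
      have := D_Z0 ω
      simp only [Set.mem_inter_iff, Set.mem_ofPred_eq]
      grind
    rw [e, measureReal_split_binary μ h_meas_D1 h_bin_D1]
    congr 3 <;> (ext ω; tauto)
  have den1 : ∀ d, μ.real ({ω | Z ω = 1} ∩ {ω | D ω = d}) =
      μ.real {ω | (Z ω = 1 ∧ D1 ω = d) ∧ D0 ω = 1} +
        μ.real {ω | (Z ω = 1 ∧ D1 ω = d) ∧ D0 ω = 0} := by
    intro d
    have e : {ω | Z ω = 1} ∩ {ω | D ω = d} = {ω | Z ω = 1 ∧ D1 ω = d} := by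
      ext ω
      have := D_Z1 ω
      simp only [Set.mem_inter_iff, Set.mem_ofPred_eq]
      grind
    rw [e, measureReal_split_binary μ h_meas_D0 h_bin_D0]
  have den0 : ∀ d, μ.real ({ω | Z ω = 0} ∩ {ω | D ω = d}) =
      μ.real {ω | (Z ω = 0 ∧ D1 ω = 1) ∧ D0 ω = d} +
        μ.real {ω | (Z ω = 0 ∧ D1 ω = 0) ∧ D0 ω = d} := by
    intro d
    have e : {ω | Z ω = 0} ∩ {ω | D ω = d} = {ω | Z ω = 0 ∧ D0 ω = d} := by
      ext ω
      have := D_Z0 ω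
      simp only [Set.mem_inter_iff, Set.mem_ofPred_eq]
      grind
    rw [e, measureReal_split_binary μ h_meas_D1 h_bin_D1]
    simp only [and_right_comm (b := D0 _ = d)]
  have h_bin_D : ∀ ω, D ω = 0 ∨ D ω = 1 := by
    intro ω
    rcases h_bin_Z ω with h | h
    · rw [D_Z0 ω h]
      exact h_bin_D0 ω
    · rw [D_Z1 ω h]
      exact h_bin_D1 ω
  have tot : ∀ z, μ.real ({ω | Z ω = z} ∩ {ω | Y' ω = 1}) =
      μ.real ({ω | Z ω = z} ∩ ({ω | Y' ω = 1} ∩ {ω | D ω = 1})) +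
        μ.real ({ω | Z ω = z} ∩ ({ω | Y' ω = 1} ∩ {ω | D ω = 0})) := by
    intro z
    simp only [← Set.inter_assoc]
    exact measureReal_split_binary μ h_meas_D h_bin_D (fun ω => Z ω = z ∧ Y' ω = 1)
  have cpr_DZ : ∀ d z, cpr μ ({ω | D ω = d} ∩ {ω | Z ω = z}) {ω | Y' ω = 1} =
      μ.real ({ω | Z ω = z} ∩ ({ω | Y' ω = 1} ∩ {ω | D ω = d})) /
        μ.real ({ω | Z ω = z} ∩ {ω | D ω = d}) := by
    intro d z
    rw [cpr_eq_div μ ((mD d).inter (mZ z)), Set.inter_comm {ω | D ω = d}, Set.inter_assoc,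
      Set.inter_comm {ω | D ω = d}]
  have CACE_eq : CACE = (μ.real {ω | (D1 ω = 1 ∧ D0 ω = 0) ∧ Y1 ω = 1} -
      μ.real {ω | (D1 ω = 1 ∧ D0 ω = 0) ∧ Y0 ω = 1}) / μ.real {ω | D1 ω = 1 ∧ D0 ω = 0} := by
    rw [h_CACE, integral_sub (integrable_binary _ h_meas_Y1 h_bin_Y1)
      (integrable_binary _ h_meas_Y0 h_bin_Y0), integral_binary _ h_meas_Y1 h_bin_Y1,
      integral_binary _ h_meas_Y0 h_bin_Y0, sub_div]
    exact congrArg₂ _ (cpr_eq_div μ (mU 1 0) _) (cpr_eq_div μ (mU 1 0) _)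
  rw [cpr_eq_div μ (mZ 1), cpr_eq_div μ (mZ 0), tot, tot] at h_CACE'
  rw [cpr_eq_div μ (mZ 1), cpr_eq_div μ (mZ 0)] at h_RDD
  simp only [cpr_DZ, cpr_eq_div μ (mZ 1), cpr_eq_div μ (mZ 0)] at h_MY h_NY
  simp only [num1 0, num1 1, num0 0, num0 1, den1, den0, joint1 0 b0 0 b0,
    joint1 0 b0 1 b1, joint1 1 b1 0 b0, joint1 1 b1 1 b1, joint0 0 b0 0 b0,
    joint0 0 b0 1 b1, joint0 1 b1 0 b0, joint0 1 b1 1 b1, indepU, defierR, defierY,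
    exA, exN] at h_CACE' h_RDD h_MY h_NY
  have hUa : 0 < μ.real {ω | D1 ω = 1 ∧ D0 ω = 1} := h_Ua
  have hUn : 0 < μ.real {ω | D1 ω = 0 ∧ D0 ω = 0} := h_Un
  have hUc : 0 < μ.real {ω | D1 ω = 1 ∧ D0 ω = 0} := h_Uc
  have memA := mixture_mem_Icc (f := 1 - SPY) h_rY hUa measureReal_nonneg
    (sub 1 1 fun ω => Y0 ω = 1)
  have memN := mixture_mem_Icc (f := 1 - SPY) h_rY hUn measureReal_nonneg
    (sub 0 0 fun ω => Y0 ω = 1)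
  have memC1 := mixture_mem_Icc (f := 1 - SPY) h_rY hUc measureReal_nonneg
    (sub 1 0 fun ω => Y1 ω = 1)
  have memC0 := mixture_mem_Icc (f := 1 - SPY) h_rY hUc measureReal_nonneg
    (sub 1 0 fun ω => Y0 ω = 1)
  have hq1 := hq 1 b1
  have hq0 := hq 0 b0
  generalize μ.real {ω | Z ω = 1} = q1 at *
  generalize μ.real {ω | Z ω = 0} = q0 at *
  generalize μ.real {ω | D1 ω = 1 ∧ D0 ω = 1} = pa at *
  generalize μ.real {ω | D1 ω = 0 ∧ D0 ω = 0} = pn at *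
  generalize μ.real {ω | D1 ω = 1 ∧ D0 ω = 0} = pc at *
  generalize μ.real {ω | (D1 ω = 1 ∧ D0 ω = 1) ∧ Y0 ω = 1} = a at *
  generalize μ.real {ω | (D1 ω = 0 ∧ D0 ω = 0) ∧ Y0 ω = 1} = n at *
  generalize μ.real {ω | (D1 ω = 1 ∧ D0 ω = 0) ∧ Y1 ω = 1} = c1 at *
  generalize μ.real {ω | (D1 ω = 1 ∧ D0 ω = 0) ∧ Y0 ω = 1} = c0 at *
  have RDD_eq : RDD = pc := by
    rw [h_RDD]
    field_simp
    ring
  have hCC : CACE' = (SNY + SPY - 1) * CACE := by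
    rw [h_CACE', CACE_eq, RDD_eq]
    field_simp
    ring
  have key : MY ≤ 1 - SPY + (SNY + SPY - 1) ∧ 1 - SPY ≤ NY ∧ CACE' ≤ CACE ∧
      CACE * (MY - NY) ≤ CACE' := by
    rw [h_MY, h_NY, RDD_eq]
    refine bounds_of_mixtures h_rY (by linarith) ?_ ?_ ?_ ?_ hCC h_CACE'_nonneg
    · convert memN using 1
      field_simp
      ring
    · convert memA using 1
      field_simp
      ring
    · convert memC1 using 1
      field_simp
      ring
    · convert memC0 using 1
      field_simp
      ring
  obtain ⟨hM, hN, h⟩ := key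
  exact ⟨by linarith, by linarith, h⟩
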